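/- For λ ∈ Γ_k and 0 ≤ l < k ≤ n, the sum of partial derivatives of the quotient operator satisfies Σ_{i=1}^n ∂/∂λ_i [ (σ_k(λ)/σ_l(λ))^{1/(k-l)} ] ≥ ( C(n,k)/C(n,l) )^{1/(k-l)}. -/

import Mathlib

open Finset

/-- The k-th elementary symmetric polynomial of `lam : Fin n → ℝ`. -/
noncomputable def sigma' {n : ℕ} (k : ℕ) (lam : Fin n → ℝ) : ℝ :=
  ∑ s ∈ Finset.univ.powersetCard k, ∏ i ∈ s, lam i

/-- The Garding cone `Γ_k`. -/
def Gamma {n : ℕ} (k : ℕ) : Set (Fin n → ℝ) :=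
  {lam | ∀ j, 1 ≤ j → j ≤ k → 0 < sigma' j lam}

/-- `σ_k(λ|i)`: the k-th elementary symmetric polynomial of λ with the i-th entry deleted. -/
noncomputable def sigmaDel {n : ℕ} (k : ℕ) (lam : Fin n → ℝ) (i : Fin n) : ℝ :=
  ∑ s ∈ (Finset.univ.erase i).powersetCard k, ∏ j ∈ s, lam j


open Polynomial in
/-- Newton's inequality for the three lowest coefficients of a product of linear factors. -/
lemma newton_low_prod (s : Multiset ℝ) :
    2 * (s.card : ℝ) * ((s.map fun r => X - C r).prod.coeff 0 *
      (s.map fun r => X - C r).prod.coeff 2) ≤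
    ((s.card : ℝ) - 1) * (s.map fun r => X - C r).prod.coeff 1 ^ 2 := by
  induction s using Multiset.induction_on with
  | empty => simp [coeff_one]
  | cons r s ih =>
    rcases Nat.eq_zero_or_pos s.card with hs | hs
    · have : s = 0 := Multiset.card_eq_zero.1 hs
      subst this
      simp [coeff_X, coeff_C]
    rw [Multiset.map_cons, Multiset.prod_cons]
    set f := (s.map fun r => X - C r).prod with hf
    have h0 : ((X - C r) * f).coeff 0 = - r * f.coeff 0 := by simp [sub_mul]
    have h1 : ((X - C r) * f).coeff 1 = f.coeff 0 - r * f.coeff 1 := by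
      rw [sub_mul, coeff_sub, coeff_C_mul, coeff_X_mul]
    have h2 : ((X - C r) * f).coeff 2 = f.coeff 1 - r * f.coeff 2 := by
      rw [sub_mul, coeff_sub, coeff_C_mul, coeff_X_mul]
    rw [h0, h1, h2, Multiset.card_cons]
    clear_value f
    generalize f.coeff 0 = a at *
    generalize f.coeff 1 = b at *
    generalize f.coeff 2 = c at *
    have hm : (0:ℝ) < s.card := by exact_mod_cast hs
    push_cast
    generalize (s.card : ℝ) = m at *
    have key : 0 ≤ m * (m * (a - r * b)^2 - 2 * (m+1) * (- r * a * (b - r * c))) := by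
      nlinarith [mul_le_mul_of_nonneg_left ih (by positivity : 0 ≤ r^2 * (m+1)),
        sq_nonneg (m * a + r * b)]
    have := nonneg_of_mul_nonneg_right key hm
    linarith

open Polynomial in
lemma newton_low_splits (g : ℝ[X]) (hg : g.Splits) :
    2 * (g.natDegree : ℝ) * (g.coeff 0 * g.coeff 2) ≤
    ((g.natDegree : ℝ) - 1) * g.coeff 1 ^ 2 := by
  have h := newton_low_prod g.roots
  rw [hg.natDegree_eq_card_roots]
  have e := hg.eq_prod_roots
  have ec : ∀ i, g.coeff i =
      g.leadingCoeff * ((g.roots.map fun r => X - C r).prod).coeff i := by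
    intro i
    conv_lhs => rw [e]
    rw [coeff_C_mul]
  rw [ec 0, ec 1, ec 2]
  nlinarith [mul_le_mul_of_nonneg_left h (sq_nonneg g.leadingCoeff)]

open Polynomial in
lemma splits_deriv (g : ℝ[X]) (hg : g.Splits) : (derivative g).Splits := by
  rw [splits_iff_card_roots] at *
  have h1 := card_roots_le_derivative g
  have h2 := card_roots' (derivative g)
  have h3 := natDegree_derivative_le g
  rcases Nat.eq_zero_or_pos g.natDegree with h0 | h0
  · omega
  · omega

open Polynomial in
lemma splits_iter_deriv (g : ℝ[X]) (hg : g.Splits) (d : ℕ) : (derivative^[d] g).Splits := by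
  induction d with
  | zero => simpa
  | succ d ih => rw [Function.iterate_succ_apply']; exact splits_deriv _ ih

open Polynomial in
/-- Newton's inequality for the coefficients of a split real polynomial. -/
lemma newton_coeff (f : ℝ[X]) (hf : f.Splits) (d e : ℕ) (hn : f.natDegree = d + 2 + e) :
    (f.coeff d / ((d + 2 + e).choose d : ℝ)) * (f.coeff (d+2) / ((d + 2 + e).choose (d+2) : ℝ))
      ≤ (f.coeff (d+1) / ((d + 2 + e).choose (d+1) : ℝ)) ^ 2 := by
  have h := newton_low_splits _ (splits_iter_deriv f hf d)
  have hdeg : (derivative^[d] f).natDegree = e + 2 := by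
    rw [← factorial_smul_hasseDeriv]
    have := natDegree_hasseDeriv f d
    rw [LinearMap.smul_apply, natDegree_smul _ (Nat.factorial_ne_zero d), this, hn]; omega
  rw [hdeg] at h
  simp only [coeff_iterate_derivative, nsmul_eq_mul] at h
  have c0 : ((0 + d).descFactorial d : ℝ) = d.factorial := by
    rw [zero_add, Nat.descFactorial_self]
  have c1 : ((1 + d).descFactorial d : ℝ) = (d+1) * d.factorial := by
    have := Nat.factorial_mul_descFactorial (show d ≤ 1 + d by omega)
    rw [show 1 + d - d = 1 by omega, Nat.factorial_one, one_mul, add_comm 1 d,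
      Nat.factorial_succ] at this
    rw [add_comm 1 d, this]; push_cast; ring
  have c2 : ((2 + d).descFactorial d : ℝ) = (d+2) * (d+1) * d.factorial / 2 := by
    have := Nat.factorial_mul_descFactorial (show d ≤ 2 + d by omega)
    rw [show 2 + d - d = 2 by omega, Nat.factorial_two, add_comm 2 d,
      Nat.factorial_succ, Nat.factorial_succ] at this
    rw [add_comm 2 d]
    have h' : (2:ℝ) * ((d+2).descFactorial d : ℝ) = (d+1+1) * ((d+1) * d.factorial) := by
      exact_mod_cast this
    linarith
  rw [c0, c1, c2] at h
  rw [zero_add, add_comm 1 d, add_comm 2 d] at h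
  have b1 : (((d + 2 + e).choose (d+1) : ℕ) : ℝ) * (d+1) = (d+2+e).choose d * (e + 2) := by
    have := Nat.choose_succ_right_eq (d+2+e) d
    rw [show d + 2 + e - d = e + 2 by omega] at this
    exact_mod_cast this
  have b2 : (((d + 2 + e).choose (d+2) : ℕ) : ℝ) * (d+2) = (d+2+e).choose (d+1) * (e + 1) := by
    have := Nat.choose_succ_right_eq (d+2+e) (d+1)
    rw [show d + 2 + e - (d+1) = e + 1 by omega] at this
    exact_mod_cast this
  have p0 : (0:ℝ) < ((d + 2 + e).choose d : ℕ) := by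
    exact_mod_cast Nat.choose_pos (by omega)
  have p1 : (0:ℝ) < ((d + 2 + e).choose (d+1) : ℕ) := by
    exact_mod_cast Nat.choose_pos (by omega)
  have p2 : (0:ℝ) < ((d + 2 + e).choose (d+2) : ℕ) := by
    exact_mod_cast Nat.choose_pos (by omega)
  have pf : (0:ℝ) < (d.factorial : ℝ) := by exact_mod_cast Nat.factorial_pos d
  have hd : (0:ℝ) ≤ d := Nat.cast_nonneg d
  have he : (0:ℝ) ≤ e := Nat.cast_nonneg e
  push_cast at h
  generalize (((d + 2 + e).choose d : ℕ) : ℝ) = C0 at *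
  generalize (((d + 2 + e).choose (d+1) : ℕ) : ℝ) = C1 at *
  generalize (((d + 2 + e).choose (d+2) : ℕ) : ℝ) = C2 at *
  generalize (d.factorial : ℝ) = F at *
  generalize f.coeff d = x at *
  generalize f.coeff (d+1) = y at *
  generalize f.coeff (d+2) = z at *
  generalize (d : ℝ) = D at *
  generalize (e : ℝ) = E at *
  have h' : (E+2) * (D+2) * (x * z) ≤ (E+1) * (D+1) * y^2 := by
    have : 0 < F^2 * (D+1) := by positivity
    refine le_of_mul_le_mul_left ?_ this
    linarith
  have e1 : C0 = C1 * (D+1) / (E+2) := by field_simp; linarith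
  have e2 : C2 = C1 * (E+1) / (D+2) := by field_simp; linarith
  have : x / C0 * (z / C2) = ((E+2) * (D+2) * (x * z)) / ((E+1) * (D+1) * C1^2) := by
    rw [e1, e2]; field_simp
  rw [this, div_pow, div_le_div_iff₀ (by positivity) (by positivity)]
  nlinarith [mul_le_mul_of_nonneg_right h' (sq_nonneg C1)]

open Polynomial in
noncomputable def sigPoly {n : ℕ} (lam : Fin n → ℝ) : ℝ[X] := ∏ i, (X + C (lam i))

open Polynomial in
lemma sigPoly_natDegree {n : ℕ} (lam : Fin n → ℝ) : (sigPoly lam).natDegree = n := by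
  unfold sigPoly
  rw [natDegree_prod_of_monic _ _ (fun i _ => monic_X_add_C _)]
  simp

open Polynomial in
lemma sigPoly_splits {n : ℕ} (lam : Fin n → ℝ) : (sigPoly lam).Splits := by
  unfold sigPoly
  exact Splits.prod (fun i _ => Splits.X_add_C _)

open Polynomial in
lemma sigma_eq_coeff {n : ℕ} (lam : Fin n → ℝ) (j : ℕ) (hj : j ≤ n) :
    sigma' j lam = (sigPoly lam).coeff (n - j) := by
  unfold sigPoly sigma'
  rw [Finset.prod_X_add_C_coeff _ _ (by simp)]
  rw [Finset.card_univ, Fintype.card_fin, Nat.sub_sub_self hj]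

/-- Normalized elementary symmetric functions. -/
noncomputable def pnorm {n : ℕ} (lam : Fin n → ℝ) (j : ℕ) : ℝ := sigma' j lam / (n.choose j : ℝ)

lemma newton_pnorm {n : ℕ} (lam : Fin n → ℝ) (j : ℕ) (hj : j + 2 ≤ n) :
    pnorm lam j * pnorm lam (j+2) ≤ pnorm lam (j+1) ^ 2 := by
  obtain ⟨d, rfl⟩ := Nat.exists_eq_add_of_le hj
  have h := newton_coeff (sigPoly lam) (sigPoly_splits lam) d j
    (by rw [sigPoly_natDegree]; omega)
  unfold pnorm
  rw [sigma_eq_coeff _ _ (by omega), sigma_eq_coeff _ _ (by omega), sigma_eq_coeff _ _ (by omega)]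
  rw [show j + 2 + d - j = d + 2 by omega, show j + 2 + d - (j + 2) = d by omega,
    show j + 2 + d - (j + 1) = d + 1 by omega]
  rw [Nat.choose_symm_of_eq_add (show j + 2 + d = j + (d+2) by omega),
    Nat.choose_symm_of_eq_add (show j + 2 + d = (j+2) + d by omega),
    Nat.choose_symm_of_eq_add (show j + 2 + d = (j+1) + (d+1) by omega)]
  have e : j + 2 + d = d + 2 + j := by omega
  simp only [← e] at h
  rw [mul_comm]; exact h

open Polynomial in
lemma sigma_shift {n : ℕ} (lam : Fin n → ℝ) (j : ℕ) (hj : j ≤ n) (t : ℝ) :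
    sigma' j (lam + t • (1 : Fin n → ℝ)) = (hasseDeriv (n - j) (sigPoly lam)).eval t := by
  rw [sigma_eq_coeff _ _ hj, ← taylor_coeff]
  congr 1
  unfold sigPoly
  rw [taylor_apply, Polynomial.prod_comp]
  refine Finset.prod_congr rfl fun i _ => ?_
  simp
  ring

open Polynomial in
lemma sigma_hasDerivAt {n : ℕ} (lam : Fin n → ℝ) (j : ℕ) (hj : j ≤ n) :
    HasDerivAt (fun t : ℝ => sigma' j (lam + t • (1 : Fin n → ℝ)))
      ((n.choose j : ℝ) * ((j : ℝ) * pnorm lam (j - 1))) 0 := by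
  have e : (fun t : ℝ => sigma' j (lam + t • (1 : Fin n → ℝ))) =
      fun t => (hasseDeriv (n - j) (sigPoly lam)).eval t := funext (sigma_shift lam j hj)
  rw [e]
  have h := (hasseDeriv (n - j) (sigPoly lam)).hasDerivAt 0
  refine h.congr_deriv ?_
  symm
  rw [← coeff_zero_eq_eval_zero, coeff_derivative, hasseDeriv_coeff]
  rcases j with _ | j
  · simp only [Nat.cast_zero, zero_mul, mul_zero]
    rw [coeff_eq_zero_of_natDegree_lt (by rw [sigPoly_natDegree]; omega)]
    simp
  · unfold pnorm
    rw [sigma_eq_coeff _ _ (by omega)]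
    rw [show j + 1 - 1 = j by omega, show 0 + 1 + (n - (j+1)) = n - j by omega]
    have b := Nat.choose_succ_right_eq n j
    have b' : ((n.choose (j+1) : ℕ) : ℝ) * ((j+1 : ℕ) : ℝ) = n.choose j * ((n - j : ℕ) : ℝ) := by
      exact_mod_cast b
    have p1 : (0:ℝ) < (n.choose j : ℕ) := by exact_mod_cast Nat.choose_pos (by omega)
    have c : (n - j).choose (n - (j+1)) = n - j := by
      rw [show n - j = (n - (j+1)) + 1 by omega, Nat.choose_succ_self_right]
    rw [c, ← mul_assoc, b']
    field_simp
    simp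

lemma ratio_mono (p : ℕ → ℝ) (k : ℕ) (hp : ∀ j ≤ k, 0 < p j)
    (hN : ∀ j, j + 2 ≤ k → p j * p (j+2) ≤ p (j+1)^2) (a b : ℕ) (hab : a ≤ b) (hb : b + 1 ≤ k) :
    p a / p (a+1) ≤ p b / p (b+1) := by
  induction b, hab using Nat.le_induction with
  | base => exact le_rfl
  | succ b hab ih =>
    refine (ih (by omega)).trans ?_
    rw [div_le_div_iff₀ (hp _ (by omega)) (hp _ (by omega))]
    have := hN b (by omega)
    rw [show b + 1 + 1 = b + 2 by omega]
    linarith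

lemma ratio_pow (p : ℕ → ℝ) (k : ℕ) (hp : ∀ j ≤ k + 1, 0 < p j)
    (hN : ∀ j, j + 2 ≤ k + 1 → p j * p (j+2) ≤ p (j+1)^2) (m : ℕ) (l : ℕ) (hl : l + m = k + 1) :
    p l ≤ (p k / p (k+1)) ^ m * p (k+1) := by
  induction m generalizing l with
  | zero => simp at hl; simp [hl]
  | succ m ih =>
    have h1 := ih (l+1) (by omega)
    have h2 := ratio_mono p (k+1) hp hN l k (by omega) le_rfl
    rw [div_le_iff₀ (hp _ (by omega))] at h2
    have r0 : 0 ≤ p k / p (k+1) := (div_pos (hp _ (by omega)) (hp _ le_rfl)).le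
    calc p l ≤ p k / p (k+1) * p (l+1) := h2
      _ ≤ p k / p (k+1) * ((p k / p (k+1)) ^ m * p (k+1)) := mul_le_mul_of_nonneg_left h1 r0
      _ = _ := by rw [pow_succ]; ring

lemma abstract_ineq (p : ℕ → ℝ) (k l : ℕ) (hl : l < k) (hp : ∀ j ≤ k, 0 < p j)
    (hN : ∀ j, j + 2 ≤ k → p j * p (j+2) ≤ p (j+1)^2) :
    1 ≤ (p k / p l) ^ ((1:ℝ) / ((k:ℝ) - l)) *
      ((1:ℝ) / ((k:ℝ) - l) * (k * p (k-1) / p k - l * p (l-1) / p l)) := by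
  obtain ⟨k, rfl⟩ : ∃ k', k = k' + 1 := ⟨k - 1, by omega⟩
  rw [show k + 1 - 1 = k by omega]
  obtain ⟨m, hm⟩ : ∃ m, l + m = k + 1 := ⟨k + 1 - l, by omega⟩
  have hm0 : m ≠ 0 := by omega
  have hmr : ((k+1 : ℕ) : ℝ) - l = m := by rw [← hm]; push_cast; ring
  have hmpos : (0:ℝ) < m := by positivity
  rw [hmr]
  have hpow := ratio_pow p k hp hN m l hm
  set r := p k / p (k+1) with hr
  have rpos : 0 < r := div_pos (hp _ (by omega)) (hp _ le_rfl)
  have hlr : (l:ℝ) * p (l-1) / p l ≤ l * r := by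
    rcases l with _ | l
    · simp
    · rw [mul_div_assoc]
      exact mul_le_mul_of_nonneg_left (ratio_mono p (k+1) hp hN l k (by omega) le_rfl)
        (Nat.cast_nonneg _)
  have h1 : r ≤ (1:ℝ) / m * (((k+1:ℕ):ℝ) * p k / p (k+1) - l * p (l-1) / p l) := by
    rw [mul_div_assoc, ← hr, div_mul_eq_mul_div, one_mul, le_div_iff₀ hmpos, ← hmr]
    linarith
  have Qpos : 0 < p (k+1) / p l := div_pos (hp _ le_rfl) (hp _ (by omega))
  refine le_trans ?_ (mul_le_mul_of_nonneg_left h1 (Real.rpow_nonneg Qpos.le _))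
  have h2 : 1 ≤ p (k+1) / p l * r ^ m := by
    rw [div_mul_eq_mul_div, le_div_iff₀ (hp _ (by omega))]; linarith
  have h3 : r = (r ^ m) ^ ((1:ℝ)/m) := by
    rw [one_div, Real.pow_rpow_inv_natCast rpos.le hm0]
  rw [h3, ← Real.mul_rpow Qpos.le (by positivity)]
  exact Real.one_le_rpow h2 (by positivity)

/-- For λ ∈ Γ_k and 0 ≤ l < k ≤ n,
Σ_i ∂/∂λ_i [(σ_k/σ_l)^{1/(k-l)}] ≥ (C(n,k)/C(n,l))^{1/(k-l)}. -/
theorem sum_deriv_quotient_ge {n k l : ℕ} (hl : l < k) (hk : k ≤ n) {lam : Fin n → ℝ}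
    (hlam : lam ∈ (Gamma k : Set (Fin n → ℝ))) :
    ((n.choose k : ℝ) / (n.choose l : ℝ)) ^ ((1 : ℝ) / ((k : ℝ) - (l : ℝ))) ≤
      ∑ i, fderiv ℝ
        (fun x : Fin n → ℝ => (sigma' k x / sigma' l x) ^ ((1 : ℝ) / ((k : ℝ) - (l : ℝ))))
        lam (Pi.single i 1) := by
  have hs : ∀ j ≤ k, 0 < sigma' j lam := by
    intro j hj
    rcases j with _ | j
    · simp [sigma']
    · exact hlam _ (by omega) hj
  have hC : ∀ j ≤ k, (0:ℝ) < (n.choose j : ℝ) := fun j hj => by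
    exact_mod_cast Nat.choose_pos (hj.trans hk)
  have hp : ∀ j ≤ k, 0 < pnorm lam j := fun j hj => div_pos (hs j hj) (hC j hj)
  have main := abstract_ineq (pnorm lam) k l hl hp
    (fun j hj => newton_pnorm lam j (hj.trans hk))
  have hsig : ∀ j ≤ k, sigma' j lam = n.choose j * pnorm lam j := fun j hj => by
    unfold pnorm; have := hC j hj; field_simp
  set q := (1 : ℝ) / ((k : ℝ) - (l : ℝ)) with hq
  have hd : ∀ j, Differentiable ℝ (fun x : Fin n → ℝ => sigma' j x) := by
    intro j; unfold sigma'; fun_prop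
  have hdiff : DifferentiableAt ℝ
      (fun x : Fin n → ℝ => (sigma' k x / sigma' l x) ^ q) lam := by
    refine DifferentiableAt.rpow_const ?_ (Or.inl (div_pos (hs k le_rfl) (hs l hl.le)).ne')
    have h1 := (hd k) lam
    have h2 := (hd l) lam
    have h3 := (hs l hl.le).ne'
    simp only [div_eq_mul_inv]
    exact h1.mul (h2.inv h3)
  rw [← map_sum]
  have hone : ∑ i : Fin n, (Pi.single i (1:ℝ) : Fin n → ℝ) = 1 := by
    exact Finset.univ_sum_single (1 : Fin n → ℝ)
  rw [hone]
  have hline : HasDerivAt (fun t : ℝ => lam + t • (1 : Fin n → ℝ)) (1 : Fin n → ℝ) 0 := by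
    simpa using ((hasDerivAt_id (0:ℝ)).smul_const (1 : Fin n → ℝ)).const_add lam
  have hF : HasFDerivAt (fun x : Fin n → ℝ => (sigma' k x / sigma' l x) ^ q)
      (fderiv ℝ (fun x : Fin n → ℝ => (sigma' k x / sigma' l x) ^ q) lam)
      (lam + (0:ℝ) • (1 : Fin n → ℝ)) := by
    simpa using hdiff.hasFDerivAt
  have hA := hF.comp_hasDerivAt (0:ℝ) hline
  have hl0 : sigma' l (lam + (0:ℝ) • (1 : Fin n → ℝ)) ≠ 0 := by
    simpa using (hs l hl.le).ne'
  have hB0 := (sigma_hasDerivAt lam k hk).div (sigma_hasDerivAt lam l (hl.le.trans hk)) hl0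
  have hB := hB0.rpow_const (p := q) (Or.inl (by
    simpa using ⟨(hs k le_rfl).ne', (hs l hl.le).ne'⟩))
  have heq := hA.unique hB
  rw [heq]
  simp only [Pi.div_apply, zero_smul, add_zero]
  have hSpos := div_pos (hs k le_rfl) (hs l hl.le)
  rw [Real.rpow_sub_one hSpos.ne']
  have hfac : sigma' k lam / sigma' l lam =
      ((n.choose k : ℝ) / n.choose l) * (pnorm lam k / pnorm lam l) := by
    rw [hsig k le_rfl, hsig l hl.le]
    have := hC l hl.le
    have := hp l hl.le
    field_simp
  have hCC : (0:ℝ) < (n.choose k : ℝ) / n.choose l := div_pos (hC k le_rfl) (hC l hl.le)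
  have hPP : 0 < pnorm lam k / pnorm lam l := div_pos (hp k le_rfl) (hp l hl.le)
  have hrp : (sigma' k lam / sigma' l lam) ^ q =
      ((n.choose k : ℝ) / n.choose l) ^ q * (pnorm lam k / pnorm lam l) ^ q := by
    rw [hfac, Real.mul_rpow hCC.le hPP.le]
  rw [hrp, hsig k le_rfl, hsig l hl.le]
  have hpos : 0 < ((n.choose k : ℝ) / n.choose l) ^ q := Real.rpow_pos_of_pos hCC q
  have fin := mul_le_mul_of_nonneg_left main hpos.le
  rw [mul_one] at fin
  refine fin.trans (le_of_eq ?_)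
  have a1 := hC l hl.le
  have a2 := hp l hl.le
  have a3 := hC k le_rfl
  have a4 := hp k le_rfl
  generalize ((n.choose k : ℝ) / n.choose l) ^ q = U
  generalize (pnorm lam k / pnorm lam l) ^ q = V
  clear_value q
  field_simp
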